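/- Let d ≥ 1, r ∈ ℤ, ω = exp(2πi/d), and c(m) = exp(π·i·m·(m+2r+d)/d). Then for every k ∈ ℤ, ∑_{m=0}^{d−1} c(m)·ω^{k·m} = conj(c(k)) · ∑_{m=0}^{d−1} c(m). (In other words, the inverse discrete Fourier transform of the sequence c equals conj(c) times its value at 0.) -/

import Mathlib

open Complex

/-- ω = exp(2πi/d). -/
noncomputable def omegaC (d : ℕ) : ℂ := Complex.exp (2 * Real.pi * Complex.I / d)

/-- The Frank–Zadoff–Chu sequence `c(m) = exp(π i m (m + 2r + d) / d)`. -/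
noncomputable def fzc (d : ℕ) (r : ℤ) (m : ℤ) : ℂ :=
  Complex.exp (Real.pi * Complex.I * m * (m + 2 * r + d) / d)

theorem fzc_mul_omega (d : ℕ) (hd : 1 ≤ d) (r k m : ℤ) :
    fzc d r m * omegaC d ^ (k * m) = (starRingEnd ℂ) (fzc d r k) * fzc d r (m + k) := by
  have h0 : (d : ℂ) ≠ 0 := by
    have : d ≠ 0 := by omega
    exact_mod_cast this
  unfold fzc omegaC
  rw [← Complex.exp_conj, ← Complex.exp_int_mul, ← Complex.exp_add, ← Complex.exp_add]
  congr 1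
  simp only [map_div₀, map_mul, map_add, Complex.conj_ofReal, Complex.conj_I, map_intCast,
    map_natCast, map_ofNat]
  push_cast
  field_simp
  ring

theorem fzc_periodic (d : ℕ) (hd : 1 ≤ d) (r m : ℤ) : fzc d r (m + d) = fzc d r m := by
  have h0 : (d : ℂ) ≠ 0 := by
    have : d ≠ 0 := by omega
    exact_mod_cast this
  unfold fzc
  rw [Complex.exp_eq_exp_iff_exists_int]
  refine ⟨m + r + d, ?_⟩
  push_cast
  field_simp
  ring

theorem fzc_shift_one (d : ℕ) (hd : 1 ≤ d) (r k : ℤ) :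
    ∑ m ∈ Finset.range d, fzc d r (m + (k + 1)) = ∑ m ∈ Finset.range d, fzc d r (m + k) := by
  have h1 := Finset.sum_range_succ (fun m : ℕ => fzc d r ((m : ℤ) + k)) d
  have h2 := Finset.sum_range_succ' (fun m : ℕ => fzc d r ((m : ℤ) + k)) d
  have h3 : fzc d r ((d : ℤ) + k) = fzc d r (((0 : ℕ) : ℤ) + k) := by
    rw [add_comm, fzc_periodic d hd]; simp
  have h4 : ∀ m : ℕ, fzc d r (m + (k + 1)) = fzc d r (((m + 1 : ℕ) : ℤ) + k) := by
    intro m; congr 1; push_cast; ring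
  rw [Finset.sum_congr rfl (fun m _ => h4 m)]
  rw [h1, h3] at h2
  exact (add_right_cancel h2).symm

theorem fzc_shift (d : ℕ) (hd : 1 ≤ d) (r k : ℤ) :
    ∑ m ∈ Finset.range d, fzc d r (m + k) = ∑ m ∈ Finset.range d, fzc d r m := by
  induction k using Int.induction_on with
  | zero => simp
  | succ i ih => rw [fzc_shift_one d hd, ih]
  | pred i ih => rw [← fzc_shift_one d hd, sub_add_cancel, ih]

/-- for `d ≥ 1`, `r : ℤ`, the inverse discrete Fourier transform of the
Frank–Zadoff–Chu sequence `c` equals `conj(c)` times its value at `0`: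
for every `k : ℤ`, `∑_{m=0}^{d-1} c(m) ω^{km} = conj(c(k)) ∑_{m=0}^{d-1} c(m)`. -/
theorem statement6 (d : ℕ) (hd : 1 ≤ d) (r : ℤ) (k : ℤ) :
    ∑ m ∈ Finset.range d, fzc d r m * omegaC d ^ (k * m) =
      (starRingEnd ℂ) (fzc d r k) * ∑ m ∈ Finset.range d, fzc d r m := by
  rw [Finset.sum_congr rfl (fun (m : ℕ) _ => fzc_mul_omega d hd r k m), ← Finset.mul_sum,
    fzc_shift d hd]
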